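/- Let k ≥ 2, n ≥ 7k², and let G be a simple graph of order n. If q(G) ≥ q(S_{n,k}), then e(G) > k(n − k). -/

import Mathlib

open Matrix BigOperators

noncomputable def edgeCount {V : Type*} (G : SimpleGraph V) : ℕ := Nat.card G.edgeSet

noncomputable def deg {V : Type*} (G : SimpleGraph V) (v : V) : ℕ := Nat.card (G.neighborSet v)

def HasPathOn {V : Type*} (G : SimpleGraph V) (l : ℕ) : Prop :=
  ∃ (u v : V) (p : G.Walk u v), p.IsPath ∧ p.support.length = l

noncomputable def signlessLaplacian {V : Type*} [Fintype V] [DecidableEq V]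
    (G : SimpleGraph V) : Matrix V V ℝ :=
  letI : DecidableRel G.Adj := Classical.decRel _
  Matrix.diagonal (fun v => (deg G v : ℝ)) + G.adjMatrix ℝ

theorem signlessLaplacian_isHermitian {V : Type*} [Fintype V] [DecidableEq V]
    (G : SimpleGraph V) : (signlessLaplacian G).IsHermitian := by
  letI : DecidableRel G.Adj := Classical.decRel _
  unfold signlessLaplacian
  refine (Matrix.isHermitian_diagonal _).add ?_
  rw [Matrix.IsHermitian, Matrix.conjTranspose_eq_transpose_of_trivial]
  exact G.isSymm_adjMatrix

/-- The `Q`-index of a graph: the largest eigenvalue of its signless Laplacian. -/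
noncomputable def qIndex {V : Type*} [Fintype V] [DecidableEq V] (G : SimpleGraph V) : ℝ :=
  ⨆ v, (signlessLaplacian_isHermitian G).eigenvalues v

noncomputable def adjMat {V : Type*} [Fintype V] (G : SimpleGraph V) : Matrix V V ℝ :=
  letI : DecidableRel G.Adj := Classical.decRel _
  G.adjMatrix ℝ

theorem adjMat_isHermitian {V : Type*} [Fintype V] (G : SimpleGraph V) :
    (adjMat G).IsHermitian := by
  letI : DecidableRel G.Adj := Classical.decRel _
  unfold adjMat
  rw [Matrix.IsHermitian, Matrix.conjTranspose_eq_transpose_of_trivial]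
  exact G.isSymm_adjMatrix

/-- The spectral radius `μ`: the largest eigenvalue of the adjacency matrix. -/
noncomputable def muIndex {V : Type*} [Fintype V] [DecidableEq V] (G : SimpleGraph V) : ℝ :=
  ⨆ v, (adjMat_isHermitian G).eigenvalues v

/-- `S_{n,k} = K_k ∨ \overline{K_{n-k}}`: the first `k` vertices form a clique joined to all. -/
def Snk (n k : ℕ) : SimpleGraph (Fin n) :=
  SimpleGraph.fromRel (fun i j => (i : ℕ) < k ∨ (j : ℕ) < k)

/-- `S_{n,k}^+`: `S_{n,k}` plus one edge inside the independent set. -/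
def SnkPlus (n k : ℕ) : SimpleGraph (Fin n) :=
  SimpleGraph.fromRel (fun i j => (i : ℕ) < k ∨ (j : ℕ) < k ∨ ((i : ℕ) = k ∧ (j : ℕ) = k + 1))

/-- `L_{t,k} = K_1 ∨ tK_k`: `t` cliques of order `k+1` sharing a common center `none`. -/
def LGraph (t k : ℕ) : SimpleGraph (Option (Fin t × Fin k)) :=
  SimpleGraph.fromRel (fun x y => x = none ∨ ∃ i a b, x = some (i, a) ∧ y = some (i, b))

/-- `K_1 ∨ (sK_k ∪ K_m)`. -/
def K1JoinCliques (s k m : ℕ) : SimpleGraph (Option ((Fin s × Fin k) ⊕ Fin m)) :=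
  SimpleGraph.fromRel (fun x y => x = none ∨
    (∃ i a b, x = some (Sum.inl (i, a)) ∧ y = some (Sum.inl (i, b))) ∨
    (∃ a b, x = some (Sum.inr a) ∧ y = some (Sum.inr b)))

/-- Two disjoint copies of `L_{s,k}` and `L_{t,k}` with their centers joined by an edge. -/
def DoubleL (s t k : ℕ) : SimpleGraph (Option (Fin s × Fin k) ⊕ Option (Fin t × Fin k)) :=
  SimpleGraph.fromRel (fun x y =>
    (∃ a b, x = Sum.inl a ∧ y = Sum.inl b ∧ (LGraph s k).Adj a b) ∨
    (∃ a b, x = Sum.inr a ∧ y = Sum.inr b ∧ (LGraph t k).Adj a b) ∨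
    (x = Sum.inl none ∧ y = Sum.inr none))

/-- `G` is (a copy of) a subgraph of `H`. -/
def IsSubgraphOf {V W : Type*} (G : SimpleGraph V) (H : SimpleGraph W) : Prop :=
  ∃ f : V ↪ W, ∀ a b, G.Adj a b → H.Adj (f a) (f b)

/-- `G` contains `m` pairwise disjoint edges. -/
def HasMatching {V : Type*} (G : SimpleGraph V) (m : ℕ) : Prop :=
  ∃ M : Finset (Sym2 V), M.card = m ∧ (∀ e ∈ M, e ∈ G.edgeSet) ∧
    ∀ e ∈ M, ∀ f ∈ M, e ≠ f → ∀ v : V, ¬(v ∈ e ∧ v ∈ f)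

/-- `G` is 2-connected: at least 3 vertices, and deleting any vertex leaves a connected graph. -/
def TwoConnected {V : Type*} [Fintype V] (G : SimpleGraph V) : Prop :=
  3 ≤ Fintype.card V ∧ ∀ v : V, (G.induce {w : V | w ≠ v}).Connected

section DegreeSums

variable {V : Type*} [Fintype V] [DecidableEq V] (G : SimpleGraph V) [DecidableRel G.Adj]

/-- Counting the edges that meet a vertex set `N`, of which at most `|N|(|N|-1)/2` lie inside `N`. -/
theorem two_mul_sum_degree_le (N : Finset V) :
    2 * ∑ u ∈ N, G.degree u ≤ 2 * G.edgeFinset.card + N.card * (N.card - 1) := by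
  have hout : ∀ u ∈ N,
      G.degree u ≤ (Finset.bipartiteAbove G.Adj Nᶜ u).card + (N.card - 1) := by
    intro u hu
    rw [← Finset.card_erase_of_mem hu, ← G.card_neighborFinset_eq_degree]
    refine (Finset.card_le_card ?_).trans (Finset.card_union_le _ _)
    intro w hw
    rw [G.mem_neighborFinset] at hw
    by_cases hwN : w ∈ N
    · simp [hwN, hw.ne']
    · simp [Finset.bipartiteAbove, hwN, hw]
  have hin : ∀ w ∈ Nᶜ, (Finset.bipartiteBelow G.Adj N w).card ≤ G.degree w := by
    intro w _
    rw [← G.card_neighborFinset_eq_degree]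
    refine Finset.card_le_card fun u hu => ?_
    rw [G.mem_neighborFinset]
    exact (Finset.mem_filter.1 hu).2.symm
  have h₁ := Finset.sum_le_sum hout
  have h₂ := Finset.sum_le_sum hin
  rw [Finset.sum_add_distrib, Finset.sum_card_bipartiteAbove_eq_sum_card_bipartiteBelow,
    Finset.sum_const, smul_eq_mul] at h₁
  have h₃ := Finset.sum_add_sum_compl N fun w => G.degree w
  rw [G.sum_degrees_eq_twice_card_edges] at h₃
  omega

theorem sum_degree_neighborFinset_add_degree_le (v : V) :
    ∑ u ∈ G.neighborFinset v, G.degree u + G.degree v ≤ 2 * G.edgeFinset.card := by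
  rw [← G.sum_degrees_eq_twice_card_edges, add_comm,
    ← Finset.sum_insert (f := fun u => G.degree u) (G.notMem_neighborFinset_self v)]
  exact Finset.sum_le_sum_of_subset (Finset.subset_univ _)

/-- An upper bound for the degree of a vertex plus the average degree of its neighbours, with
denominators cleared. -/
theorem sum_degree_neighborFinset_le (v : V) :
    (∑ u ∈ G.neighborFinset v, (G.degree u : ℝ) + (G.degree v : ℝ) ^ 2) * (Fintype.card V - 1) ≤
      G.degree v * (2 * G.edgeFinset.card +
        ((Fintype.card V : ℝ) - 1) * (Fintype.card V - 2)) := by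
  have hA := two_mul_sum_degree_le G (G.neighborFinset v)
  have hC := sum_degree_neighborFinset_add_degree_le G v
  have hlt : ∀ u, G.degree u + 1 ≤ Fintype.card V := G.degree_lt_card_verts
  have hB : ∑ u ∈ G.neighborFinset v, (G.degree u : ℝ) ≤
      G.degree v * ((Fintype.card V : ℝ) - 1) := by
    rw [← G.card_neighborFinset_eq_degree, ← nsmul_eq_mul]
    refine Finset.sum_le_card_nsmul _ _ _ fun u _ => ?_
    have : (G.degree u : ℝ) + 1 ≤ Fintype.card V := mod_cast hlt u
    linarith
  rcases Nat.eq_zero_or_pos (G.degree v) with h0 | hpos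
  · have hN : G.neighborFinset v = ∅ := by
      rwa [← Finset.card_eq_zero, G.card_neighborFinset_eq_degree]
    simp [h0, hN]
  rw [G.card_neighborFinset_eq_degree] at hA
  have hA' : 2 * ∑ u ∈ G.neighborFinset v, (G.degree u : ℝ) ≤
      2 * G.edgeFinset.card + (G.degree v : ℝ) * (G.degree v - 1) := by
    have := (Nat.cast_le (α := ℝ)).2 hA
    push_cast [Nat.cast_sub hpos] at this
    exact this
  have hC' : ∑ u ∈ G.neighborFinset v, (G.degree u : ℝ) + G.degree v ≤
      2 * G.edgeFinset.card := by exact_mod_cast hC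
  have hd : (1 : ℝ) ≤ G.degree v := mod_cast hpos
  have hdN : (G.degree v : ℝ) ≤ (Fintype.card V : ℝ) - 1 := by
    have : (G.degree v : ℝ) + 1 ≤ Fintype.card V := mod_cast hlt v
    linarith
  have hint : 0 ≤ ((Fintype.card V : ℝ) - 1 - G.degree v) *
      ((Fintype.card V : ℝ) - 1 - G.degree v - 1) := by
    rcases (hlt v).eq_or_lt with h | h
    · rw [← h]; simp
    · have : (G.degree v : ℝ) + 1 + 1 ≤ Fintype.card V := mod_cast h
      exact mul_nonneg (by linarith) (by linarith)
  generalize ∑ u ∈ G.neighborFinset v, (G.degree u : ℝ) = S at *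
  obtain ⟨N, hN⟩ : ∃ N : ℝ, (Fintype.card V : ℝ) - 1 = N := ⟨_, rfl⟩
  rw [show (Fintype.card V : ℝ) - 2 = N - 1 by linarith]
  rw [hN] at hB hdN hint ⊢
  generalize (G.degree v : ℝ) = d at *
  generalize (G.edgeFinset.card : ℝ) = m at *
  rcases le_total S (d ^ 2) with hS | hS
  · nlinarith [mul_le_mul_of_nonneg_left hC' (show 0 ≤ d by linarith),
      mul_le_mul_of_nonneg_left hS (show 0 ≤ N - d by linarith),
      mul_nonneg (show 0 ≤ d by linarith) hint]
  · have hAd := mul_le_mul_of_nonneg_left hA' (show 0 ≤ d by linarith)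
    rcases le_total N (2 * d) with h | h
    · nlinarith [mul_le_mul_of_nonneg_left hS (show 0 ≤ 2 * d - N by linarith),
        mul_nonneg (show 0 ≤ d by linarith) hint]
    · nlinarith [mul_le_mul_of_nonneg_left hB (show 0 ≤ N - 2 * d by linarith),
        mul_nonneg (show 0 ≤ d by linarith)
          (mul_nonneg (show 0 ≤ d - 1 by linarith) (show 0 ≤ N - d by linarith))]

end DegreeSums

section QIndex

variable {V : Type*} [Fintype V] [DecidableEq V] (G : SimpleGraph V)

theorem signlessLaplacian_mulVec_apply [DecidableRel G.Adj] (x : V → ℝ) (v : V) :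
    (signlessLaplacian G *ᵥ x) v = G.degree v * x v + ∑ u ∈ G.neighborFinset v, x u := by
  have hdeg : deg G v = G.degree v := by
    rw [deg, Nat.card_eq_fintype_card, G.card_neighborSet_eq_degree]
  rw [signlessLaplacian, Matrix.add_mulVec, Pi.add_apply, Matrix.mulVec_diagonal, hdeg]
  congr 1
  rw [← G.adjMatrix_mulVec_apply]
  congr!

theorem le_qIndex_of_mulVec_eq {x : V → ℝ} (hx : x ≠ 0) {θ : ℝ}
    (h : signlessLaplacian G *ᵥ x = θ • x) : θ ≤ qIndex G := by
  have hmem : θ ∈ spectrum ℝ (signlessLaplacian G) := by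
    rw [← Matrix.spectrum_toLin']
    refine Module.End.HasEigenvalue.mem_spectrum
      (Module.End.hasEigenvalue_of_hasEigenvector (x := x) ⟨?_, hx⟩)
    rw [Module.End.mem_eigenspace_iff, Matrix.toLin'_apply, h]
  rw [(signlessLaplacian_isHermitian G).spectrum_real_eq_range_eigenvalues] at hmem
  obtain ⟨i, rfl⟩ := hmem
  exact le_ciSup (Set.finite_range _).bddAbove i

theorem exists_mulVec_eq_qIndex [Nonempty V] :
    ∃ x : V → ℝ, x ≠ 0 ∧ signlessLaplacian G *ᵥ x = qIndex G • x := by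
  have hQ := signlessLaplacian_isHermitian G
  obtain ⟨i, hi⟩ := exists_eq_ciSup_of_finite (f := hQ.eigenvalues)
  refine ⟨hQ.eigenvectorBasis i, fun h => ?_, ?_⟩
  · exact hQ.eigenvectorBasis.orthonormal.ne_zero i (by ext v; exact congrFun h v)
  · rw [hQ.mulVec_eigenvectorBasis, hi, qIndex]

/-- Merris' bound: `q(G)` is at most the degree of some vertex plus the average degree of its
neighbours. -/
theorem exists_qIndex_mul_degree_le [Nonempty V] [DecidableRel G.Adj] (hq : 0 < qIndex G) :
    ∃ v, 0 < G.degree v ∧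
      qIndex G * G.degree v ≤ ∑ u ∈ G.neighborFinset v, (G.degree u : ℝ) + (G.degree v : ℝ) ^ 2 := by
  obtain ⟨x, hx0, hx⟩ := exists_mulVec_eq_qIndex G
  have hrow : ∀ v, G.degree v * x v + ∑ u ∈ G.neighborFinset v, x u = qIndex G * x v := by
    intro v
    rw [← signlessLaplacian_mulVec_apply, hx, Pi.smul_apply, smul_eq_mul]
  have hiso : ∀ v, x v ≠ 0 → 0 < G.degree v := by
    intro v hv
    by_contra h0
    have h0 : G.degree v = 0 := by omega
    have hN : G.neighborFinset v = ∅ := by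
      rwa [← Finset.card_eq_zero, G.card_neighborFinset_eq_degree]
    have := hrow v
    rw [h0, hN] at this
    simp [hq.ne', hv] at this
  obtain ⟨w, hw⟩ : ∃ w, x w ≠ 0 := Function.ne_iff.1 hx0
  obtain ⟨v, -, hmax⟩ := Finset.exists_max_image Finset.univ
    (fun v => |x v| / G.degree v) Finset.univ_nonempty
  have hratio : 0 < |x v| / G.degree v :=
    (div_pos (abs_pos.2 hw) (Nat.cast_pos.2 (hiso w hw))).trans_le (hmax w (Finset.mem_univ w))
  have hxv : x v ≠ 0 := by
    intro h
    simp [h] at hratio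
  have hd : (0 : ℝ) < G.degree v := Nat.cast_pos.2 (hiso v hxv)
  have hle : ∀ u, |x u| ≤ G.degree u * (|x v| / G.degree v) := by
    intro u
    by_cases hu : x u = 0
    · rw [hu, abs_zero]
      positivity
    · rw [← div_le_iff₀' (Nat.cast_pos.2 (hiso u hu))]
      exact hmax u (Finset.mem_univ u)
  refine ⟨v, hiso v hxv, ?_⟩
  have hsum : qIndex G * |x v| ≤ G.degree v * |x v| +
      (∑ u ∈ G.neighborFinset v, (G.degree u : ℝ)) * (|x v| / G.degree v) := by
    calc qIndex G * |x v| = |G.degree v * x v + ∑ u ∈ G.neighborFinset v, x u| := by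
          rw [hrow, abs_mul, abs_of_pos hq]
      _ ≤ |G.degree v * x v| + ∑ u ∈ G.neighborFinset v, |x u| :=
          (abs_add_le _ _).trans (add_le_add_right (Finset.abs_sum_le_sum_abs _ _) _)
      _ ≤ _ := by
          rw [abs_mul, Nat.abs_cast, Finset.sum_mul]
          exact add_le_add_right (Finset.sum_le_sum fun u _ => hle u) _
  have hxd : |x v| = G.degree v * (|x v| / G.degree v) := by field_simp
  rw [hxd, mul_div_cancel_left₀ _ hd.ne'] at hsum
  refine le_of_mul_le_mul_right ?_ hratio
  linarith

/-- The bound `q(G) ≤ 2e(G)/(n-1) + n - 2`, with denominators cleared. -/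
theorem qIndex_mul_le [Nonempty V] (hq : 0 < qIndex G) :
    qIndex G * ((Fintype.card V : ℝ) - 1) ≤
      2 * edgeCount G + ((Fintype.card V : ℝ) - 1) * (Fintype.card V - 2) := by
  classical
  have hedge : edgeCount G = G.edgeFinset.card := by
    rw [edgeCount, Nat.card_eq_fintype_card, SimpleGraph.edgeFinset_card]
  obtain ⟨v, hv, hle⟩ := exists_qIndex_mul_degree_le G hq
  have hN : (0 : ℝ) ≤ (Fintype.card V : ℝ) - 1 :=
    sub_nonneg.2 (mod_cast Fintype.card_pos)
  have hS := sum_degree_neighborFinset_le G v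
  have := (mul_le_mul_of_nonneg_right hle hN).trans hS
  rw [hedge]
  refine le_of_mul_le_mul_left ?_ (Nat.cast_pos (α := ℝ).2 hv)
  linarith

end QIndex

section CompleteSplit

variable {n k : ℕ}

theorem card_filter_val_lt (hkn : k ≤ n) :
    (Finset.univ.filter fun i : Fin n => (i : ℕ) < k).card = k := by
  rw [Fin.card_filter_val_lt, min_eq_right hkn]

theorem Snk_neighborFinset_of_lt [DecidableRel (Snk n k).Adj] {v : Fin n} (hv : (v : ℕ) < k) :
    (Snk n k).neighborFinset v = Finset.univ.erase v := by
  ext w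
  rw [SimpleGraph.mem_neighborFinset, Snk, SimpleGraph.fromRel_adj]
  simp [hv, eq_comm]

theorem Snk_neighborFinset_of_le [DecidableRel (Snk n k).Adj] {v : Fin n} (hv : k ≤ (v : ℕ)) :
    (Snk n k).neighborFinset v = Finset.univ.filter fun i : Fin n => (i : ℕ) < k := by
  ext w
  rw [SimpleGraph.mem_neighborFinset, Snk, SimpleGraph.fromRel_adj]
  simp only [Finset.mem_filter, Finset.mem_univ, true_and, ne_eq, Fin.ext_iff]
  omega

/-- The larger root of `θ² - (n+2k-2)θ + 2k(k-1)` is an eigenvalue of the signless Laplacian of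
`S_{n,k}`. -/
theorem le_qIndex_Snk (hk : 0 < k) (hkn : k < n) {θ : ℝ}
    (hθ : θ ^ 2 - (n + 2 * k - 2) * θ + 2 * k * (k - 1) = 0) : θ ≤ qIndex (Snk n k) := by
  classical
  let x : Fin n → ℝ := fun i => if (i : ℕ) < k then θ - k else k
  have hcard := card_filter_val_lt hkn.le
  refine le_qIndex_of_mulVec_eq (x := x) _ (Function.ne_iff.2 ⟨⟨k, hkn⟩, ?_⟩) (funext fun v => ?_)
  · simp [x, hk.ne']
  rw [signlessLaplacian_mulVec_apply, ← SimpleGraph.card_neighborFinset_eq_degree, Pi.smul_apply,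
    smul_eq_mul]
  rcases lt_or_ge (v : ℕ) k with hv | hv
  · have hsum : ∑ i, x i = k * (θ - k) + (n - k) * k := by
      have hcompl := Finset.card_filter_add_card_filter_not (s := Finset.univ)
        (fun i : Fin n => (i : ℕ) < k)
      rw [hcard, Finset.card_univ, Fintype.card_fin] at hcompl
      have hcompl' : ((Finset.univ.filter fun i : Fin n => ¬ (i : ℕ) < k).card : ℝ) = n - k := by
        rw [eq_sub_iff_add_eq']
        exact_mod_cast hcompl
      simp only [x]
      rw [Finset.sum_ite, Finset.sum_const, Finset.sum_const, hcard, nsmul_eq_mul, nsmul_eq_mul,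
        hcompl']
    have hn : ((n - 1 : ℕ) : ℝ) = n - 1 := by
      rw [Nat.cast_sub (by omega), Nat.cast_one]
    have hxv : x v = θ - k := if_pos hv
    rw [Snk_neighborFinset_of_lt hv, Finset.card_erase_of_mem (Finset.mem_univ v),
      Finset.card_univ, Fintype.card_fin, hn, Finset.sum_erase_eq_sub (Finset.mem_univ v), hsum, hxv]
    linear_combination -hθ
  · have hsum : ∑ i ∈ Finset.univ.filter (fun i : Fin n => (i : ℕ) < k), x i = k * (θ - k) := by
      rw [Finset.sum_congr rfl fun i hi => if_pos (Finset.mem_filter.1 hi).2, Finset.sum_const,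
        hcard, nsmul_eq_mul]
    have hxv : x v = k := if_neg (not_lt.2 hv)
    rw [Snk_neighborFinset_of_le hv, hsum, hcard, hxv]
    ring

theorem lt_qIndex_Snk (hk : 0 < k) (hkn : k < n) {B : ℝ}
    (hB : B ^ 2 - (n + 2 * k - 2) * B + 2 * k * (k - 1) < 0) : B < qIndex (Snk n k) := by
  obtain ⟨s, hs⟩ : ∃ s : ℝ, (n : ℝ) + 2 * k - 2 = s := ⟨_, rfl⟩
  rw [hs] at hB
  have hdisc : (2 * B - s) ^ 2 < s ^ 2 - 8 * k * (k - 1) := by nlinarith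
  have hsq := Real.sq_sqrt ((sq_nonneg _).trans hdisc.le)
  have hlt := Real.lt_sqrt_of_sq_lt hdisc
  refine lt_of_lt_of_le (b := (s + √(s ^ 2 - 8 * k * (k - 1))) / 2) (by linarith)
    (le_qIndex_Snk hk hkn ?_)
  rw [hs]
  linear_combination hsq / 4

end CompleteSplit

/-- If `k ≥ 2`, `n ≥ 7k²` and `q(G) ≥ q(S_{n,k})`, then `e(G) > k(n - k)`. -/
theorem stmt_9 (k n : ℕ) (hk : 2 ≤ k) (hn : 7 * k ^ 2 ≤ n) (G : SimpleGraph (Fin n))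
    (hq : qIndex (Snk n k) ≤ qIndex G) : k * (n - k) < edgeCount G := by 
  have hkn : k < n := by nlinarith
  have hk' : (2 : ℝ) ≤ k := mod_cast hk
  have hn' : 7 * (k : ℝ) ^ 2 ≤ n := mod_cast hn
  have : Nonempty (Fin n) := ⟨⟨k, hkn⟩⟩
  have hN : (0 : ℝ) < n - 1 := by nlinarith
  by_contra! hle
  have hle' : (edgeCount G : ℝ) ≤ k * (n - k) := by
    have := (Nat.cast_le (α := ℝ)).2 hle
    rwa [Nat.cast_mul, Nat.cast_sub hkn.le] at this
  set ε : ℝ := 2 * k * (k - 1) / (n - 1) with hε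
  have hεN : ε * (n - 1) = 2 * k * (k - 1) := div_mul_cancel₀ _ hN.ne'
  have hε0 : 0 < ε := div_pos (by nlinarith) hN
  have hε1 : ε < 1 := by
    rw [hε, div_lt_one hN]
    nlinarith
  have hlt : (n : ℝ) + 2 * k - 2 - ε < qIndex (Snk n k) :=
    lt_qIndex_Snk (by omega) hkn (by nlinarith)
  have hbound := qIndex_mul_le G (by nlinarith)
  rw [Fintype.card_fin] at hbound
  have := mul_lt_mul_of_pos_right (hlt.trans_le hq) hN
  nlinarith
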